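/- Let n be even and let M be the conjugacy class of the symmetric group S_n consisting of fixed-point-free involutions (products of n/2 disjoint transpositions). For each irreducible unitary representation λ of S_n on an inner product space V_λ of dimension d_λ, fix a finite frame B_λ = {b_j} of unit vectors in V_λ with positive weights {a_j} satisfying Σ_j a_j |b_j⟩⟨b_j| = id; for m ∈ M let Π_m^λ = (1/2)(id + λ(m)) and r_λ = rk Π_m^λ (independent of m ∈ M). Consider the joint distribution in which m is uniform on M and λ is observed with probability P(λ) = 2 d_λ r_λ / n!, and define the conditional distribution P_m on B_λ by P_m(b_j) = a_j ‖Π_m^λ b_j‖²/r_λ and the natural distribution N on B_λ by N(b_j) = a_j/d_λ. Then there is a constant δ > 0 such that for all sufficiently large even n, with probability at least 1 − e^{−δn} over the choice of m and λ, the total variation (L¹) distance ‖P_m − N‖₁ = Σ_j |P_m(b_j) − N(b_j)| is less than e^{−δn}. -/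

import Mathlib

open scoped Classical

/-- The rank-one operator `|b⟩⟨b| : v ↦ ⟨b,v⟩·b`. -/
noncomputable def outerSelf {V : Type*} [NormedAddCommGroup V] [InnerProductSpace ℂ V]
    (b : V) : V →ₗ[ℂ] V :=
  (innerₛₗ ℂ b).smulRight b

/-- For an involution `m`, the operator `Π_m = (1/2)(id + ρ(m))`, the orthogonal
projection onto the `+1`-eigenspace of `ρ(m)`. -/
noncomputable def halfProj {G V : Type*} [Group G] [NormedAddCommGroup V]
    [InnerProductSpace ℂ V] (ρ : G →* (V ≃ₗᵢ[ℂ] V)) (m : G) : V →ₗ[ℂ] V :=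
  (2⁻¹ : ℂ) • (LinearMap.id + ((ρ m).toLinearEquiv : V →ₗ[ℂ] V))

open Equiv Finset

/-- The fixed-point-free involutions of `Fin n`. -/
noncomputable def fpfInvolutions (n : ℕ) : Finset (Perm (Fin n)) :=
  Finset.univ.filter (fun m : Equiv.Perm (Fin n) => m * m = 1 ∧ ∀ x, m x ≠ x)

/-- The number of permutations commuting with `g`. -/
noncomputable def centralizerCard {G : Type*} [Group G] [Fintype G] (g : G) : ℕ :=
  (univ.filter fun h : G => h * g = g * h).card

section Counting

variable {n : ℕ}

lemma mem_fpfInvolutions {m : Perm (Fin n)} :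
    m ∈ fpfInvolutions n ↔ m * m = 1 ∧ ∀ x, m x ≠ x := by
  simp [fpfInvolutions]

lemma fpfInvolutions_apply_apply {m : Perm (Fin n)} (hm : m ∈ fpfInvolutions n) (x : Fin n) :
    m (m x) = x := by
  rw [← Perm.mul_apply, (mem_fpfInvolutions.1 hm).1, Perm.one_apply]

lemma fpfInvolutions_inv {m : Perm (Fin n)} (hm : m ∈ fpfInvolutions n) : m⁻¹ = m :=
  inv_eq_of_mul_eq_one_left (mem_fpfInvolutions.1 hm).1

/-- The points which the involution `m` moves upwards. -/
noncomputable def ascents (m : Perm (Fin n)) : Finset (Fin n) := univ.filter fun x => x < m x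

lemma apply_mem_ascents_iff {m : Perm (Fin n)} (hm : m ∈ fpfInvolutions n) (x : Fin n) :
    m x ∈ ascents m ↔ x ∉ ascents m := by
  have h := (mem_fpfInvolutions.1 hm).2 x
  simp only [ascents, mem_filter, mem_univ, true_and, fpfInvolutions_apply_apply hm, not_lt]
  exact ⟨le_of_lt, fun h' => lt_of_le_of_ne h' h⟩

/-- Two fixed-point-free involutions with the same ascents glue to a permutation. -/
lemma injective_glue {A : Finset (Fin n)} {m m' : Perm (Fin n)} (hm : m ∈ fpfInvolutions n)
    (hm' : m' ∈ fpfInvolutions n) (hA : ascents m = A) (hA' : ascents m' = A) :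
    Function.Injective fun x => if x ∈ A then m x else m' x := by
  intro x y hxy
  have h1 := fun x => apply_mem_ascents_iff hm x
  have h2 := fun x => apply_mem_ascents_iff hm' x
  rw [hA] at h1
  rw [hA'] at h2
  by_cases hx : x ∈ A <;> by_cases hy : y ∈ A <;> simp only [hx, hy, if_true, if_false] at hxy
  · exact m.injective hxy
  · exact absurd ((h2 y).2 hy) (hxy ▸ fun h => (h1 x).1 h hx)
  · exact absurd ((h2 x).2 hx) (hxy ▸ fun h => (h1 y).1 h hy)
  · exact m'.injective hxy

lemma sq_card_invariant_ascents_le (f : Fin n → Fin n) (A : Finset (Fin n)) :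
    ((fpfInvolutions n).filter fun m : Perm (Fin n) => f ∘ m = f ∧ ascents m = A).card ^ 2 ≤
      (univ.filter fun g : Perm (Fin n) => f ∘ g = f).card := by
  set S := (fpfInvolutions n).filter fun m : Perm (Fin n) => f ∘ m = f ∧ ascents m = A with hS
  have hmem : ∀ m ∈ S, m ∈ fpfInvolutions n ∧ f ∘ m = f ∧ ascents m = A := by
    intro m hm
    simpa [hS] using hm
  rw [sq, ← card_product]
  refine card_le_card_of_injOn
    (fun p => if h : p.1 ∈ S ∧ p.2 ∈ S then Equiv.ofBijective
      (fun x => if x ∈ A then p.1 x else p.2 x)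
      (Finite.injective_iff_bijective.1 (injective_glue (hmem _ h.1).1 (hmem _ h.2).1
        (hmem _ h.1).2.2 (hmem _ h.2).2.2)) else 1) ?_ ?_
  · rintro ⟨m, m'⟩ hp
    have hp' : m ∈ S ∧ m' ∈ S := by simpa using hp
    simp only [coe_filter, mem_univ, true_and, Set.mem_ofPred_eq, dif_pos hp']
    funext x
    simp only [Function.comp_apply, Equiv.ofBijective_apply]
    split_ifs
    · exact congrFun (hmem _ hp'.1).2.1 x
    · exact congrFun (hmem _ hp'.2).2.1 x
  · rintro ⟨m, m'⟩ hp ⟨k, k'⟩ hq hpq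
    have hp' : m ∈ S ∧ m' ∈ S := by simpa using hp
    have hq' : k ∈ S ∧ k' ∈ S := by simpa using hq
    simp only [dif_pos hp', dif_pos hq'] at hpq
    have hx : ∀ x, (if x ∈ A then m x else m' x) = if x ∈ A then k x else k' x := fun x => by
      simpa using DFunLike.congr_fun hpq x
    obtain ⟨a1, -, b1⟩ := hmem _ hp'.1
    obtain ⟨a2, -, b2⟩ := hmem _ hp'.2
    obtain ⟨a3, -, b3⟩ := hmem _ hq'.1
    obtain ⟨a4, -, b4⟩ := hmem _ hq'.2
    have hin : ∀ x ∈ A, m x = k x := fun x h => by simpa [h] using hx x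
    have hout : ∀ x ∉ A, m' x = k' x := fun x h => by simpa [h] using hx x
    ext1
    · ext1 x
      by_cases h : x ∈ A
      · exact hin x h
      · have : m x ∈ A := by rw [← b1] at h ⊢; exact (apply_mem_ascents_iff a1 x).2 h
        have h2 := hin _ this
        rw [fpfInvolutions_apply_apply a1] at h2
        dsimp only
        rw [h2, fpfInvolutions_apply_apply a3, ← h2]
    · ext1 x
      by_cases h : x ∈ A
      · have : m' x ∉ A := by
          rw [← b2] at h ⊢; exact fun h' => (apply_mem_ascents_iff a2 x).1 h' h
        have h2 := hout _ this
        rw [fpfInvolutions_apply_apply a2] at h2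
        dsimp only
        rw [h2, fpfInvolutions_apply_apply a4, ← h2]
      · exact hout x h

lemma sq_card_invariant_le (f : Fin n → Fin n) :
    ((fpfInvolutions n).filter fun m : Perm (Fin n) => f ∘ m = f).card ^ 2 ≤
      4 ^ n * (univ.filter fun g : Perm (Fin n) => f ∘ g = f).card := by
  rw [card_eq_sum_card_fiberwise (f := ascents) (t := univ) (fun _ _ => by simp)]
  refine (sq_sum_le_card_mul_sum_sq).trans ?_
  simp only [filter_filter]
  calc _ ≤ (univ : Finset (Finset (Fin n))).card *
        ∑ _A : Finset (Fin n), (univ.filter fun g : Perm (Fin n) => f ∘ g = f).card := by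
          exact Nat.mul_le_mul_left _ (sum_le_sum fun A _ => sq_card_invariant_ascents_le f A)
    _ = _ := by
          rw [sum_const, smul_eq_mul, ← mul_assoc]
          simp [← mul_pow]

lemma card_monotone_le : (univ.filter fun f : Fin n → Fin n => Monotone f).card ≤ 4 ^ n := by
  have : Fintype.card (Finset (Fin (2 * n))) = 4 ^ n := by
    rw [Fintype.card_finset, Fintype.card_fin, pow_mul]; norm_num
  rw [← this, ← card_univ]
  let F : (Fin n → Fin n) → Fin n → Fin (2 * n) := fun f i => ⟨i + f i, by omega⟩
  have hF : ∀ f : Fin n → Fin n, Monotone f → StrictMono (F f) := by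
    intro f hf i j hij
    have : f i ≤ f j := hf hij.le
    simp only [F, Fin.mk_lt_mk]
    omega
  refine card_le_card_of_injOn (fun f => univ.image (F f)) (fun _ _ => by simp) ?_
  intro f hf g hg hfg
  have hf' : Monotone f := by simpa using hf
  have hg' : Monotone g := by simpa using hg
  have : Set.range (F f) = Set.range (F g) := by
    have h := congrArg (fun s : Finset (Fin (2 * n)) => (s : Set (Fin (2 * n)))) hfg
    simpa using h
  have h := ((hF f hf').range_inj (hF g hg')).1 this
  funext i
  have := congrArg Fin.val (congrFun h i)
  simp only [F] at this
  omega

lemma sum_card_stabilizer_le :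
    ∑ f : Fin n → Fin n, (univ.filter fun g : Perm (Fin n) => f ∘ g = f).card ≤
      4 ^ n * n.factorial := by
  rw [← card_sigma]
  calc _ ≤ ((univ.filter fun f : Fin n → Fin n => Monotone f) ×ˢ
        (univ : Finset (Perm (Fin n)))).card := by
        refine card_le_card_of_injOn
          (fun p => (p.1 ∘ Tuple.sort p.1, (Tuple.sort p.1)⁻¹ * p.2)) ?_ ?_
        · rintro ⟨f, g⟩ -
          simpa using Tuple.monotone_sort f
        · rintro ⟨f, g⟩ hp ⟨f', g'⟩ hq h
          have hf : f ∘ g = f := by simpa using hp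
          have hf' : f' ∘ g' = f' := by simpa using hq
          obtain ⟨h1, h2⟩ := Prod.ext_iff.1 h
          dsimp only at h1 h2
          have key : ∀ (f : Fin n → Fin n) (g : Perm (Fin n)), f ∘ g = f →
              f = (f ∘ Tuple.sort f) ∘ ((Tuple.sort f)⁻¹ * g : Perm (Fin n)) := by
            intro f g hfg
            funext x
            simpa using (congrFun hfg x).symm
          have e : f = f' := by rw [key f g hf, key f' g' hf', h1, h2]
          subst e
          rw [mul_left_cancel h2]
    _ ≤ _ := by
        rw [card_product, card_univ, Fintype.card_perm, Fintype.card_fin]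
        gcongr
        exact card_monotone_le

/-- The number of colourings of `Fin n` by `Fin n` that are constant on the orbits of `m, m'`. -/
noncomputable def invariantColorings (m m' : Perm (Fin n)) : ℕ :=
  (univ.filter fun f : Fin n → Fin n => f ∘ m = f ∧ f ∘ m' = f).card

lemma sum_invariantColorings_le :
    ∑ m ∈ fpfInvolutions n, ∑ m' ∈ fpfInvolutions n, invariantColorings m m' ≤
      16 ^ n * n.factorial := by
  calc _ = ∑ f : Fin n → Fin n, ((fpfInvolutions n).filter fun m : Perm (Fin n) => f ∘ m = f).card ^ 2 := by
        have h : ∀ f : Fin n → Fin n,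
            ((fpfInvolutions n).filter fun m : Perm (Fin n) => f ∘ m = f).card ^ 2 =
              ∑ m ∈ fpfInvolutions n, ∑ m' ∈ fpfInvolutions n,
                if f ∘ m = f ∧ f ∘ m' = f then 1 else 0 := by
          intro f
          rw [card_filter, sq, sum_mul_sum]
          refine sum_congr rfl fun m _ => sum_congr rfl fun m' _ => ?_
          by_cases h1 : f ∘ m = f <;> by_cases h2 : f ∘ m' = f <;> simp [h1, h2]
        rw [sum_congr rfl fun f _ => h f]
        conv_rhs => rw [sum_comm]
        refine sum_congr rfl fun m _ => ?_
        conv_rhs => rw [sum_comm]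
        exact sum_congr rfl fun m' _ => card_filter _ _
    _ ≤ ∑ f : Fin n → Fin n, 4 ^ n * (univ.filter fun g : Perm (Fin n) => f ∘ g = f).card :=
        sum_le_sum fun f _ => sq_card_invariant_le f
    _ ≤ 4 ^ n * (4 ^ n * n.factorial) := by
        rw [← mul_sum]
        gcongr
        exact sum_card_stabilizer_le
    _ = _ := by rw [← mul_assoc, ← mul_pow]; norm_num

/-- The number of ways of writing `g` as a product of two fixed-point-free involutions. -/
noncomputable def fpfFactorizations (g : Perm (Fin n)) : ℕ :=
  ((fpfInvolutions n ×ˢ fpfInvolutions n).filter fun p => p.1 * p.2 = g).card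

lemma fpfFactorizations_fst_injOn (g : Perm (Fin n)) :
    Set.InjOn Prod.fst (SetLike.coe ((fpfInvolutions n ×ˢ fpfInvolutions n).filter
      fun p => p.1 * p.2 = g)) := by
  rintro ⟨a, b⟩ hp ⟨a', b'⟩ hq h
  have h1 : a * b = g := (mem_filter.1 hp).2
  have h2 : a' * b' = g := (mem_filter.1 hq).2
  dsimp only at h
  subst h
  rw [mul_left_cancel (h1.trans h2.symm)]

lemma fpfFactorizations_le_card (g : Perm (Fin n)) :
    fpfFactorizations g ≤ (fpfInvolutions n).card :=
  card_le_card_of_injOn Prod.fst (fun _ hp => (mem_product.1 (mem_filter.1 hp).1).1)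
    (fpfFactorizations_fst_injOn g)

lemma fpfFactorizations_le_sq {m m' : Perm (Fin n)} (hm : m ∈ fpfInvolutions n)
    (hm' : m' ∈ fpfInvolutions n) :
    fpfFactorizations (m * m') ≤ invariantColorings m m' ^ 2 := by
  let R : Fin n → Fin n → Prop := fun x y => y = m x ∨ y = m' x
  let r : Fin n → Fin n := fun x => Quot.out (Quot.mk R x)
  have hr1 : r ∘ m = r := by
    funext x
    exact congrArg Quot.out (Quot.sound (r := R) (Or.inl rfl)).symm
  have hr2 : r ∘ m' = r := by
    funext x
    exact congrArg Quot.out (Quot.sound (r := R) (Or.inr rfl)).symm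
  rw [sq, invariantColorings, ← card_product]
  refine card_le_card_of_injOn
    (fun p => ((p.1 : Fin n → Fin n) ∘ r, ((p.1 : Fin n → Fin n) ∘ m) ∘ r)) ?_ ?_
  · rintro p -
    simp only [coe_product, coe_filter, mem_univ, true_and, Set.mem_prod, Set.mem_ofPred_eq,
      Function.comp_assoc, hr1, hr2, and_self]
  · rintro ⟨a, b⟩ hp ⟨a', b'⟩ hq h
    refine fpfFactorizations_fst_injOn (m * m') hp hq ?_
    have hab := mem_filter.1 hp
    have hab' := mem_filter.1 hq
    have inverts : ∀ a b : Perm (Fin n), a ∈ fpfInvolutions n → b ∈ fpfInvolutions n →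
        a * b = m * m' → ∀ x, a (m (m' x)) = m' (m (a x)) ∧ a (m' (m x)) = m (m' (a x)) := by
      intro a b ha hb h x
      have e : a * (m * m') = b := by rw [← h, ← mul_assoc, (mem_fpfInvolutions.1 ha).1, one_mul]
      have e' : (m' * m) * a = b := by
        have : (m * m')⁻¹ = m' * m := by
          rw [mul_inv_rev, fpfInvolutions_inv hm, fpfInvolutions_inv hm']
        rw [← this, ← h, mul_inv_rev, fpfInvolutions_inv ha, fpfInvolutions_inv hb, mul_assoc,
          (mem_fpfInvolutions.1 ha).1, mul_one]
      have e1 : ∀ x, a (m (m' x)) = m' (m (a x)) := fun x => DFunLike.congr_fun (e.trans e'.symm) x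
      refine ⟨e1 x, ?_⟩
      have := e1 (m' (m x))
      rw [fpfInvolutions_apply_apply hm', fpfInvolutions_apply_apply hm] at this
      rw [this, fpfInvolutions_apply_apply hm', fpfInvolutions_apply_apply hm]
    have i1 := inverts a b (mem_product.1 hab.1).1 (mem_product.1 hab.1).2 hab.2
    have i2 := inverts a' b' (mem_product.1 hab'.1).1 (mem_product.1 hab'.1).2 hab'.2
    obtain ⟨h1, h2⟩ := Prod.ext_iff.1 h
    let Z : Fin n → Prop := fun x => a x = a' x ∧ a (m x) = a' (m x)
    have hZ1 : ∀ x, Z x → Z (m x) := by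
      rintro x ⟨u, v⟩
      refine ⟨v, ?_⟩
      rwa [fpfInvolutions_apply_apply hm]
    have hZ2 : ∀ x, Z x → Z (m' x) := by
      rintro x ⟨u, v⟩
      constructor
      · have j1 := (i1 (m x)).2
        have j2 := (i2 (m x)).2
        rw [fpfInvolutions_apply_apply hm] at j1 j2
        rw [j1, j2, v]
      · rw [(i1 x).1, (i2 x).1, u]
    have hR : ∀ x y, R x y → Z x = Z y := by
      rintro x y (rfl | rfl)
      · exact propext ⟨hZ1 x, fun h => by simpa [fpfInvolutions_apply_apply hm] using hZ1 _ h⟩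
      · exact propext ⟨hZ2 x, fun h => by simpa [fpfInvolutions_apply_apply hm'] using hZ2 _ h⟩
    dsimp only
    ext1 x
    have hx : Z (r x) := ⟨congrFun h1 x, congrFun h2 x⟩
    have hq : Quot.lift Z hR (Quot.mk R (r x)) = Quot.lift Z hR (Quot.mk R x) :=
      congrArg _ (Quot.out_eq _)
    exact ((show Z (r x) = Z x from hq) ▸ hx).1

/-- The number of quadruples of fixed-point-free involutions with `a * b = c * d`. -/
noncomputable def fpfQuadruples (n : ℕ) : ℕ :=
  ∑ a ∈ fpfInvolutions n, ∑ b ∈ fpfInvolutions n, fpfFactorizations (a * b)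

lemma sq_fpfQuadruples_le :
    fpfQuadruples n ^ 2 ≤ (fpfInvolutions n).card * (16 ^ n * n.factorial) ^ 2 := by
  have h : (fpfQuadruples n : ℝ) ≤
      √((fpfInvolutions n).card : ℝ) * (16 ^ n * n.factorial : ℕ) := by
    calc (fpfQuadruples n : ℝ) ≤ ∑ a ∈ fpfInvolutions n, ∑ b ∈ fpfInvolutions n,
          √((fpfInvolutions n).card : ℝ) * invariantColorings a b := by
          rw [fpfQuadruples]
          push_cast
          refine sum_le_sum fun a ha => sum_le_sum fun b hb => ?_
          refine le_of_sq_le_sq ?_ (by positivity)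
          rw [mul_pow, Real.sq_sqrt (by positivity), sq]
          exact_mod_cast Nat.mul_le_mul (fpfFactorizations_le_card _)
            (fpfFactorizations_le_sq ha hb)
      _ ≤ _ := by
          simp_rw [← mul_sum]
          gcongr
          exact_mod_cast sum_invariantColorings_le
  have h2 : (fpfQuadruples n : ℝ) ^ 2 ≤
      (fpfInvolutions n).card * ((16 ^ n * n.factorial : ℕ) : ℝ) ^ 2 := by
    calc (fpfQuadruples n : ℝ) ^ 2 ≤ _ := pow_le_pow_left₀ (by positivity) h 2
      _ = _ := by rw [mul_pow, Real.sq_sqrt (by positivity)]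
  exact_mod_cast h2

lemma sum_fpfInvolutions_mul (F : Perm (Fin n) → ℝ) :
    ∑ p ∈ fpfInvolutions n ×ˢ fpfInvolutions n, F (p.1 * p.2) =
      ∑ h, (fpfFactorizations h : ℝ) * F h := by
  rw [← sum_fiberwise (fpfInvolutions n ×ˢ fpfInvolutions n) (fun p => p.1 * p.2)]
  refine sum_congr rfl fun h _ => ?_
  rw [fpfFactorizations, ← nsmul_eq_mul, ← sum_const]
  exact sum_congr rfl fun p hp => congrArg F (mem_filter.1 hp).2

lemma sum_sq_fpfFactorizations :
    ∑ h : Perm (Fin n), (fpfFactorizations h : ℝ) ^ 2 = fpfQuadruples n := by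
  simp_rw [sq]
  rw [← sum_fpfInvolutions_mul, sum_product, fpfQuadruples]
  push_cast
  rfl

lemma sum_quadruples_le (c : Perm (Fin n) → ℝ) (hc : ∀ g, 0 ≤ c g) :
    ∑ p ∈ fpfInvolutions n ×ˢ fpfInvolutions n, ∑ q ∈ fpfInvolutions n ×ˢ fpfInvolutions n,
      c ((p.1 * p.2)⁻¹ * (q.1 * q.2)) ≤ fpfQuadruples n * ∑ g, c g := by
  have h1 : ∀ p : Perm (Fin n) × Perm (Fin n),
      ∑ q ∈ fpfInvolutions n ×ˢ fpfInvolutions n, c ((p.1 * p.2)⁻¹ * (q.1 * q.2)) =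
      ∑ g, (fpfFactorizations (p.1 * p.2 * g) : ℝ) * c g := fun p => by
    rw [sum_fpfInvolutions_mul fun h => c ((p.1 * p.2)⁻¹ * h)]
    exact Fintype.sum_equiv (Equiv.mulLeft (p.1 * p.2)⁻¹) _ _ (by simp [mul_assoc])
  simp_rw [h1]
  rw [sum_fpfInvolutions_mul fun h => ∑ g, (fpfFactorizations (h * g) : ℝ) * c g, mul_sum]
  simp_rw [mul_sum]
  rw [sum_comm]
  refine sum_le_sum fun g _ => ?_
  simp_rw [← mul_assoc, ← sum_mul]
  refine mul_le_mul_of_nonneg_right ?_ (hc g)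
  have h2 : ∑ h : Perm (Fin n), (fpfFactorizations (h * g) : ℝ) ^ 2 = fpfQuadruples n := by
    rw [← sum_sq_fpfFactorizations]
    exact Fintype.sum_equiv (Equiv.mulRight g) _ _ (by simp)
  calc _ ≤ ∑ h : Perm (Fin n), ((fpfFactorizations h : ℝ) ^ 2 +
        (fpfFactorizations (h * g) : ℝ) ^ 2) / 2 :=
        sum_le_sum fun h _ => by
          nlinarith [sq_nonneg ((fpfFactorizations h : ℝ) - fpfFactorizations (h * g))]
    _ = _ := by rw [← sum_div, sum_add_distrib, sum_sq_fpfFactorizations, h2]; ring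

lemma card_conjClasses_perm_le : Nat.card (ConjClasses (Perm (Fin n))) ≤ 2 ^ n := by
  have h1 : Nat.card (ConjClasses (Perm (Fin n))) ≤
      Nat.card (Nat.Partition (Fintype.card (Fin n))) := by
    refine Nat.card_le_card_of_injective
      (Quotient.lift Perm.partition fun a b h => Perm.partition_eq_of_isConj.1 h) ?_
    rintro ⟨a⟩ ⟨b⟩ h
    exact Quotient.sound (Perm.partition_eq_of_isConj.2 h)
  have h2 : Nat.card (Nat.Partition (Fintype.card (Fin n))) ≤
      Nat.card (Composition (Fintype.card (Fin n))) :=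
    Nat.card_le_card_of_surjective _ Nat.Partition.ofComposition_surj
  refine h1.trans (h2.trans ?_)
  rw [Nat.card_eq_fintype_card, composition_card, Fintype.card_fin]
  exact Nat.pow_le_pow_right (by norm_num) (Nat.sub_le n 1)

lemma sum_centralizerCard_le :
    ∑ g : Perm (Fin n), centralizerCard g ≤ 2 ^ n * n.factorial := by
  have h := card_comm_eq_card_conjClasses_mul_card (Perm (Fin n))
  have h' : ∑ g : Perm (Fin n), centralizerCard g =
      Nat.card {p : Perm (Fin n) × Perm (Fin n) // Commute p.1 p.2} := by
    rw [Nat.card_eq_fintype_card, Fintype.card_subtype, card_filter, Fintype.sum_prod_type_right]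
    refine sum_congr rfl fun g _ => ?_
    rw [centralizerCard, card_filter]
    rfl
  rw [h', h, Nat.card_perm, Nat.card_fin]
  gcongr
  exact card_conjClasses_perm_le

lemma factorial_le_card_fpfInvolutions (hn : Even n) :
    n.factorial ≤ 2 ^ n * (fpfInvolutions n).card ^ 2 := by
  obtain ⟨k, rfl⟩ := hn
  have h := Perm.card_of_cycleType_mul_eq (Fin (k + k)) (Multiset.replicate k 2)
  rw [if_pos ⟨by simp; omega, fun a ha => (Multiset.eq_of_mem_replicate ha).ge⟩] at h
  have h1 : ∏ m ∈ (Multiset.replicate k 2).toFinset,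
      (Multiset.count m (Multiset.replicate k 2)).factorial = k.factorial := by
    rcases Nat.eq_zero_or_pos k with rfl | hk
    · simp
    · rw [Multiset.toFinset_replicate, if_neg hk.ne', prod_singleton,
        Multiset.count_replicate_self]
  have h2 : Fintype.card (Fin (k + k)) - (Multiset.replicate k 2).sum = 0 := by
    simp; omega
  rw [h1, h2, Multiset.prod_replicate, Nat.factorial_zero, one_mul, Fintype.card_fin] at h
  have hle : (univ.filter fun g : Perm (Fin (k + k)) =>
      g.cycleType = Multiset.replicate k 2).card ≤ (fpfInvolutions (k + k)).card := by
    refine card_le_card fun g hg => ?_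
    have hg' : g.cycleType = Multiset.replicate k 2 := by simpa using hg
    refine mem_fpfInvolutions.2 ⟨?_, fun x => ?_⟩
    · rw [← sq]
      refine orderOf_dvd_iff_pow_eq_one.1 ?_
      rw [← Perm.lcm_cycleType, hg']
      exact Multiset.lcm_dvd.2 fun b hb => (Multiset.eq_of_mem_replicate hb).dvd
    · have : g.support = univ := by
        rw [← card_eq_iff_eq_univ, ← Perm.sum_cycleType, hg']
        simp; omega
      exact Perm.mem_support.1 (this ▸ mem_univ x)
  have h3 : (k + k).factorial ≤ (fpfInvolutions (k + k)).card * (2 ^ k * k.factorial) := by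
    rw [← h]
    gcongr
  have h4 : k.factorial * k.factorial ≤ (k + k).factorial :=
    Nat.le_of_dvd (Nat.factorial_pos _) (Nat.factorial_mul_factorial_dvd_factorial_add k k)
  refine Nat.le_of_mul_le_mul_left ?_ (Nat.factorial_pos (k + k))
  calc (k + k).factorial * (k + k).factorial
      ≤ ((fpfInvolutions (k + k)).card * (2 ^ k * k.factorial)) *
        ((fpfInvolutions (k + k)).card * (2 ^ k * k.factorial)) := Nat.mul_le_mul h3 h3
    _ = k.factorial * k.factorial * (2 ^ (k + k) * (fpfInvolutions (k + k)).card ^ 2) := by ring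
    _ ≤ _ := Nat.mul_le_mul_right _ h4

end Counting

section Frames

open ComplexConjugate

variable {G V J : Type*} [Group G] [NormedAddCommGroup V] [InnerProductSpace ℂ V]

/-- The linear representation underlying a unitary representation. -/
noncomputable def unitaryRep (ρ : G →* (V ≃ₗᵢ[ℂ] V)) : Representation ℂ G V where
  toFun g := ((ρ g).toLinearEquiv : V →ₗ[ℂ] V)
  map_one' := by ext; simp
  map_mul' g h := by ext; simp

lemma inner_unitary_apply (ρ : G →* (V ≃ₗᵢ[ℂ] V)) (g h : G) (u v : V) :
    inner ℂ (ρ g u) (ρ h v) = inner ℂ u (ρ (g⁻¹ * h) v) := by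
  have h1 : ρ h = ρ g * ρ (g⁻¹ * h) := by rw [← map_mul, mul_inv_cancel_left]
  rw [h1]
  exact (ρ g).inner_map_map u _

lemma unitaryRep_character_eq_sum {κ : Type*} [Fintype κ] (ρ : G →* (V ≃ₗᵢ[ℂ] V))
    (e : OrthonormalBasis κ ℂ V) (g : G) :
    (unitaryRep ρ).character g = ∑ x, inner ℂ (e x) (ρ g (e x)) :=
  LinearMap.trace_eq_sum_inner _ e

lemma sum_inner_mul_inner_eq {K κ : Type*} [Fintype κ] (s : Finset K) (u w : K → V)
    (e : OrthonormalBasis κ ℂ V) :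
    ∑ g ∈ s, ∑ h ∈ s, inner ℂ (u g) (u h) * inner ℂ (w h) (w g) =
      ((∑ x, ∑ y, ‖∑ h ∈ s, inner ℂ (e x) (u h) * inner ℂ (w h) (e y)‖ ^ 2 : ℝ) : ℂ) := by
  have h1 : ∀ x y, ((‖∑ h ∈ s, inner ℂ (e x) (u h) * inner ℂ (w h) (e y)‖ ^ 2 : ℝ) : ℂ) =
      ∑ g ∈ s, ∑ h ∈ s, (inner ℂ (u g) (e x) * inner ℂ (e x) (u h)) *
        (inner ℂ (w h) (e y) * inner ℂ (e y) (w g)) := by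
    intro x y
    push_cast
    rw [← Complex.conj_mul', map_sum, sum_mul_sum]
    refine sum_congr rfl fun g _ => sum_congr rfl fun h _ => ?_
    rw [map_mul, inner_conj_symm, inner_conj_symm]
    ring
  rw [Complex.ofReal_sum]
  simp_rw [Complex.ofReal_sum, h1]
  simp_rw [sum_comm (s := (univ : Finset κ)) (t := s)]
  refine sum_congr rfl fun g _ => sum_congr rfl fun h _ => ?_
  rw [← e.sum_inner_mul_inner (u g) (u h), ← e.sum_inner_mul_inner (w h) (w g), sum_mul_sum]

variable [FiniteDimensional ℂ V]

lemma unitaryRep_character_inv (ρ : G →* (V ≃ₗᵢ[ℂ] V)) (g : G) :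
    (unitaryRep ρ).character g⁻¹ = conj ((unitaryRep ρ).character g) := by
  rw [unitaryRep_character_eq_sum ρ (stdOrthonormalBasis ℂ V),
    unitaryRep_character_eq_sum ρ (stdOrthonormalBasis ℂ V), map_sum]
  refine sum_congr rfl fun x _ => ?_
  rw [inner_conj_symm]
  simpa using (inner_unitary_apply ρ g 1 (stdOrthonormalBasis ℂ V x)
    (stdOrthonormalBasis ℂ V x)).symm

lemma frame_trace [Fintype J] {b : J → V} {a : J → ℝ}
    (hab : ∑ j, (a j : ℂ) • outerSelf (b j) = LinearMap.id) (X : V →ₗ[ℂ] V) :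
    ∑ j, (a j : ℂ) * inner ℂ (b j) (X (b j)) = LinearMap.trace ℂ V X := by
  have h : X = ∑ j, (a j : ℂ) • X ∘ₗ outerSelf (b j) := by
    conv_lhs => rw [← LinearMap.comp_id X, ← hab]
    ext v
    simp
  conv_rhs => rw [h, map_sum]
  refine sum_congr rfl fun j _ => ?_
  have h' : X ∘ₗ outerSelf (b j) = (innerₛₗ ℂ (b j)).smulRight (X (b j)) := by
    ext v
    simp [outerSelf]
  rw [h', map_smul, LinearMap.trace_smulRight, smul_eq_mul]
  rfl

lemma frame_sum_weights [Fintype J] {b : J → V} {a : J → ℝ} (hb : ∀ j, ‖b j‖ = 1)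
    (hab : ∑ j, (a j : ℂ) • outerSelf (b j) = LinearMap.id) :
    ∑ j, a j = Module.finrank ℂ V := by
  have h := frame_trace hab LinearMap.id
  simp only [LinearMap.id_coe, id_eq, inner_self_eq_norm_sq_to_K, hb] at h
  rw [LinearMap.trace_id] at h
  have h' : ((∑ j, a j : ℝ) : ℂ) = ((Module.finrank ℂ V : ℝ) : ℂ) := by
    push_cast
    simpa using h
  exact_mod_cast h'

lemma exists_orthonormalBasis_mem {b : V} (hb : ‖b‖ = 1) :
    ∃ (u : Finset V) (e : OrthonormalBasis u ℂ V) (x₀ : u), e x₀ = b := by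
  have h : Orthonormal ℂ (Subtype.val : ({b} : Set V) → V) := by
    rw [orthonormal_iff_ite]
    rintro ⟨x, rfl⟩ ⟨y, hy⟩
    obtain rfl : y = x := hy
    simp [inner_self_eq_norm_sq_to_K, hb]
  obtain ⟨u, e, hu, he⟩ := h.exists_orthonormalBasis_extension
  exact ⟨u, e, ⟨b, hu rfl⟩, by rw [he]⟩

/-- Cauchy–Schwarz for the positive-definite function `g ↦ |⟨b, ρ(g) b⟩|²`. -/
lemma sq_sum_sq_norm_inner_le {K : Type*} (s : Finset K) (γ : K → G) (ρ : G →* (V ≃ₗᵢ[ℂ] V))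
    {b : V} (hb : ‖b‖ = 1) :
    (∑ k ∈ s, ‖(inner ℂ b (ρ (γ k) b) : ℂ)‖ ^ 2) ^ 2 ≤
      ∑ k ∈ s, ∑ l ∈ s, ‖(inner ℂ b (ρ ((γ k)⁻¹ * γ l) b) : ℂ)‖ ^ 2 := by
  obtain ⟨u, e, x₀, rfl⟩ := exists_orthonormalBasis_mem hb
  have h := sum_inner_mul_inner_eq s (fun k => ρ (γ k) (e x₀)) (fun k => ρ (γ k) (e x₀)) e
  have h1 : ∀ k l, inner ℂ (ρ (γ k) (e x₀)) (ρ (γ l) (e x₀)) *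
      inner ℂ (ρ (γ l) (e x₀)) (ρ (γ k) (e x₀)) =
      ((‖(inner ℂ (e x₀) (ρ ((γ k)⁻¹ * γ l) (e x₀)) : ℂ)‖ ^ 2 : ℝ) : ℂ) := by
    intro k l
    push_cast
    rw [← inner_unitary_apply, ← inner_conj_symm (ρ (γ l) (e x₀)), Complex.mul_conj']
  simp_rw [h1] at h
  have h2 : ∑ k ∈ s, ∑ l ∈ s, ‖(inner ℂ (e x₀) (ρ ((γ k)⁻¹ * γ l) (e x₀)) : ℂ)‖ ^ 2 =
      ∑ x, ∑ y, ‖∑ h ∈ s,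
        inner ℂ (e x) (ρ (γ h) (e x₀)) * inner ℂ (ρ (γ h) (e x₀)) (e y)‖ ^ 2 := by
    exact_mod_cast h
  rw [h2]
  have h3 : (∑ k ∈ s, ‖(inner ℂ (e x₀) (ρ (γ k) (e x₀)) : ℂ)‖ ^ 2) ^ 2 =
      ‖∑ h ∈ s, inner ℂ (e x₀) (ρ (γ h) (e x₀)) * inner ℂ (ρ (γ h) (e x₀)) (e x₀)‖ ^ 2 := by
    have : ∑ h ∈ s, inner ℂ (e x₀) (ρ (γ h) (e x₀)) * inner ℂ (ρ (γ h) (e x₀)) (e x₀) =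
        ((∑ k ∈ s, ‖(inner ℂ (e x₀) (ρ (γ k) (e x₀)) : ℂ)‖ ^ 2 : ℝ) : ℂ) := by
      push_cast
      refine sum_congr rfl fun k _ => ?_
      rw [← inner_conj_symm (ρ (γ k) (e x₀)) (e x₀), Complex.mul_conj']
    rw [this, Complex.norm_real, Real.norm_eq_abs, sq_abs]
  rw [h3]
  let f : u → u → ℝ := fun x y => ‖∑ h ∈ s,
    inner ℂ (e x) (ρ (γ h) (e x₀)) * inner ℂ (ρ (γ h) (e x₀)) (e y)‖ ^ 2
  have hf : ∀ x y, 0 ≤ f x y := fun x y => by positivity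
  calc f x₀ x₀ ≤ ∑ y, f x₀ y := single_le_sum (fun y _ => hf x₀ y) (mem_univ x₀)
    _ ≤ ∑ x, ∑ y, f x y :=
        single_le_sum (f := fun x => ∑ y, f x y) (fun x _ => sum_nonneg fun y _ => hf x y)
          (mem_univ x₀)

lemma sum_sq_norm_inner_le_re {K : Type*} (s : Finset K) (γ : K → G) (ρ : G →* (V ≃ₗᵢ[ℂ] V))
    {b : V} (hb : ‖b‖ = 1) :
    ∑ k ∈ s, ∑ l ∈ s, ‖(inner ℂ b (ρ ((γ k)⁻¹ * γ l) b) : ℂ)‖ ^ 2 ≤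
      (∑ k ∈ s, ∑ l ∈ s, inner ℂ b (ρ ((γ k)⁻¹ * γ l) b) *
        conj ((unitaryRep ρ).character ((γ k)⁻¹ * γ l))).re := by
  obtain ⟨u, e, x₀, rfl⟩ := exists_orthonormalBasis_mem hb
  let F : u → ℂ := fun y => ∑ k ∈ s, ∑ l ∈ s,
    inner ℂ (ρ (γ k) (e x₀)) (ρ (γ l) (e x₀)) * inner ℂ (ρ (γ l) (e y)) (ρ (γ k) (e y))
  have hF : ∀ y, 0 ≤ (F y).re := by
    intro y
    have h := sum_inner_mul_inner_eq s (fun k => ρ (γ k) (e x₀)) (fun k => ρ (γ k) (e y)) e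
    simp only [F]
    rw [h, Complex.ofReal_re]
    positivity
  have h1 : ∑ k ∈ s, ∑ l ∈ s, ‖(inner ℂ (e x₀) (ρ ((γ k)⁻¹ * γ l) (e x₀)) : ℂ)‖ ^ 2 =
      (F x₀).re := by
    simp only [F, Complex.re_sum]
    refine sum_congr rfl fun k _ => sum_congr rfl fun l _ => ?_
    rw [← inner_unitary_apply, ← inner_conj_symm (ρ (γ l) (e x₀)), Complex.mul_conj']
    norm_cast
  have h2 : ∑ k ∈ s, ∑ l ∈ s, inner ℂ (e x₀) (ρ ((γ k)⁻¹ * γ l) (e x₀)) *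
      conj ((unitaryRep ρ).character ((γ k)⁻¹ * γ l)) = ∑ y, F y := by
    simp only [F]
    rw [sum_comm (s := univ)]
    refine sum_congr rfl fun k _ => ?_
    rw [sum_comm (s := univ)]
    refine sum_congr rfl fun l _ => ?_
    rw [unitaryRep_character_eq_sum ρ e, map_sum, ← mul_sum, inner_unitary_apply]
    congr 1
    refine sum_congr rfl fun y _ => ?_
    rw [← inner_unitary_apply, inner_conj_symm]
  rw [h1, h2, show (∑ y, F y).re = ∑ y, (F y).re from Complex.re_sum _ _]
  exact single_le_sum (f := fun y => (F y).re) (fun y _ => hF y) (mem_univ x₀)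

lemma frame_sum_sq_norm_inner_le [Fintype J] {K : Type*} (s : Finset K) (γ : K → G)
    (ρ : G →* (V ≃ₗᵢ[ℂ] V)) {b : J → V} {a : J → ℝ} (hb : ∀ j, ‖b j‖ = 1) (ha : ∀ j, 0 < a j)
    (hab : ∑ j, (a j : ℂ) • outerSelf (b j) = LinearMap.id) :
    ∑ j, a j * ∑ k ∈ s, ∑ l ∈ s, ‖(inner ℂ (b j) (ρ ((γ k)⁻¹ * γ l) (b j)) : ℂ)‖ ^ 2 ≤
      ∑ k ∈ s, ∑ l ∈ s, ‖(unitaryRep ρ).character ((γ k)⁻¹ * γ l)‖ ^ 2 := by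
  calc _ ≤ ∑ j, a j * (∑ k ∈ s, ∑ l ∈ s, inner ℂ (b j) (ρ ((γ k)⁻¹ * γ l) (b j)) *
        conj ((unitaryRep ρ).character ((γ k)⁻¹ * γ l))).re :=
        sum_le_sum fun j _ => mul_le_mul_of_nonneg_left
          (sum_sq_norm_inner_le_re s γ ρ (hb j)) (ha j).le
    _ = (∑ j, (a j : ℂ) * ∑ k ∈ s, ∑ l ∈ s, inner ℂ (b j) (ρ ((γ k)⁻¹ * γ l) (b j)) *
        conj ((unitaryRep ρ).character ((γ k)⁻¹ * γ l))).re := by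
        rw [Complex.re_sum]
        exact sum_congr rfl fun j _ => (Complex.re_ofReal_mul _ _).symm
    _ = (∑ k ∈ s, ∑ l ∈ s, (unitaryRep ρ).character ((γ k)⁻¹ * γ l) *
        conj ((unitaryRep ρ).character ((γ k)⁻¹ * γ l))).re := by
        congr 1
        simp_rw [mul_sum]
        rw [sum_comm]
        refine sum_congr rfl fun k _ => ?_
        rw [sum_comm]
        refine sum_congr rfl fun l _ => ?_
        simp_rw [← mul_assoc, ← sum_mul]
        congr 1
        exact frame_trace hab (unitaryRep ρ ((γ k)⁻¹ * γ l))
    _ = _ := by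
        simp_rw [Complex.mul_conj', ← Complex.ofReal_pow, ← Complex.ofReal_sum, Complex.ofReal_re]

end Frames

section Characters

open ComplexConjugate

variable {G : Type*} [Group G]

lemma isIrreducible_unitaryRep {W : Type*} [NormedAddCommGroup W] [InnerProductSpace ℂ W]
    [Nontrivial W] {ρ : G →* (W ≃ₗᵢ[ℂ] W)}
    (h : ∀ U : Submodule ℂ W, (∀ g : G, ∀ v ∈ U, ρ g v ∈ U) → U = ⊥ ∨ U = ⊤) :
    (unitaryRep ρ).IsIrreducible where
  exists_pair_ne := by
    refine ⟨⊥, ⊤, fun h' => bot_ne_top (α := Submodule ℂ W) ?_⟩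
    exact congrArg Subrepresentation.toSubmodule h'
  eq_bot_or_eq_top U := by
    refine (h U.toSubmodule fun g v hv => U.apply_mem_toSubmodule g hv).imp ?_ ?_ <;>
    exact fun h' => Subrepresentation.toSubmodule_injective h'

variable [Fintype G] {ι : Type*} {V : ι → Type*} [∀ i, NormedAddCommGroup (V i)]
  [∀ i, InnerProductSpace ℂ (V i)] [∀ i, FiniteDimensional ℂ (V i)]

lemma sum_character_mul_conj {ρ : ∀ i, G →* (V i ≃ₗᵢ[ℂ] V i)}
    (hirr : ∀ i, ∀ U : Submodule ℂ (V i), (∀ g : G, ∀ v ∈ U, ρ i g v ∈ U) → U = ⊥ ∨ U = ⊤)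
    (hdisj : ∀ i j, i ≠ j → ∀ f : V i →ₗ[ℂ] V j, (∀ g x, f (ρ i g x) = ρ j g (f x)) → f = 0)
    (i j : ι) [Nontrivial (V i)] :
    ∑ g, (unitaryRep (ρ j)).character g * conj ((unitaryRep (ρ i)).character g) =
      if i = j then (Fintype.card G : ℂ) else 0 := by
  have hN : (Nat.card G : ℂ) ≠ 0 := by exact_mod_cast Nat.card_pos.ne'
  have : Invertible (Nat.card G : ℂ) := invertibleOfNonzero hN
  have h := Representation.card_inv_mul_sum_char_mul_char_eq_finrank
    (unitaryRep (ρ i)) (unitaryRep (ρ j))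
  simp_rw [unitaryRep_character_inv] at h
  rw [inv_mul_eq_iff_eq_mul₀ hN] at h
  rw [h, ← Nat.card_eq_fintype_card]
  split_ifs with hij
  · subst hij
    have := isIrreducible_unitaryRep (hirr i)
    rw [Representation.IsIrreducible.finrank_intertwiningMap_self]
    simp
  · have : Subsingleton
        (Representation.IntertwiningMap (unitaryRep (ρ i)) (unitaryRep (ρ j))) := by
      have h0 : ∀ f : Representation.IntertwiningMap (unitaryRep (ρ i)) (unitaryRep (ρ j)),
          f.toLinearMap = 0 := fun f =>
        hdisj i j hij _ fun g x => LinearMap.congr_fun (f.isIntertwining' g) x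
      refine ⟨fun f f' => ?_⟩
      have := (h0 f).trans (h0 f').symm
      ext x
      exact LinearMap.congr_fun this x
    rw [Module.finrank_zero_of_subsingleton]
    simp

/-- Bessel's inequality for irreducible characters. -/
lemma sum_sq_norm_sum_character_le [Fintype ι] {ρ : ∀ i, G →* (V i ≃ₗᵢ[ℂ] V i)}
    (hirr : ∀ i, ∀ U : Submodule ℂ (V i), (∀ g : G, ∀ v ∈ U, ρ i g v ∈ U) → U = ⊥ ∨ U = ⊤)
    (hdisj : ∀ i j, i ≠ j → ∀ f : V i →ₗ[ℂ] V j, (∀ g x, f (ρ i g x) = ρ j g (f x)) → f = 0)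
    (f : G → ℂ) :
    ∑ i, ‖∑ g, conj ((unitaryRep (ρ i)).character g) * f g‖ ^ 2 ≤
      Fintype.card G * ∑ g, ‖f g‖ ^ 2 := by
  let N : ℝ := Fintype.card G
  have hN : 0 < N := by simp only [N]; exact_mod_cast Fintype.card_pos
  let v : {i // Nontrivial (V i)} → EuclideanSpace ℂ G := fun i =>
    WithLp.toLp 2 fun g => ((√N)⁻¹ : ℝ) * (unitaryRep (ρ i)).character g
  have hv : Orthonormal ℂ v := by
    rw [orthonormal_iff_ite]
    rintro ⟨i, hi⟩ ⟨j, hj⟩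
    have h := sum_character_mul_conj hirr hdisj i j
    have h' : inner ℂ (v ⟨i, hi⟩) (v ⟨j, hj⟩) = ((N⁻¹ : ℝ) : ℂ) *
        ∑ g, (unitaryRep (ρ j)).character g * conj ((unitaryRep (ρ i)).character g) := by
      rw [PiLp.inner_apply, mul_sum]
      refine sum_congr rfl fun g _ => ?_
      have hs : ((N⁻¹ : ℝ) : ℂ) = ((√N)⁻¹ : ℝ) * ((√N)⁻¹ : ℝ) := by
        rw [← Complex.ofReal_mul, ← mul_inv, Real.mul_self_sqrt hN.le]
      simp only [v, RCLike.inner_apply, map_mul, Complex.conj_ofReal, hs]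
      ring
    rw [h', h]
    simp only [Subtype.mk.injEq]
    split_ifs
    · rw [← Complex.ofReal_natCast, ← Complex.ofReal_mul, inv_mul_cancel₀ hN.ne',
        Complex.ofReal_one]
    · simp
  have h := hv.sum_inner_products_le (WithLp.toLp 2 f) (s := univ)
  rw [EuclideanSpace.norm_sq_eq] at h
  have hinner : ∀ i, ‖inner ℂ (v i) (WithLp.toLp 2 f : EuclideanSpace ℂ G)‖ ^ 2 =
      N⁻¹ * ‖∑ g, conj ((unitaryRep (ρ i)).character g) * f g‖ ^ 2 := by
    intro i
    have : inner ℂ (v i) (WithLp.toLp 2 f : EuclideanSpace ℂ G) =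
        ((√N)⁻¹ : ℝ) * ∑ g, conj ((unitaryRep (ρ i)).character g) * f g := by
      rw [PiLp.inner_apply, mul_sum]
      refine sum_congr rfl fun g _ => ?_
      simp only [v, RCLike.inner_apply, map_mul, Complex.conj_ofReal]
      ring
    rw [this, norm_mul, mul_pow, Complex.norm_real, Real.norm_eq_abs, sq_abs, inv_pow,
      Real.sq_sqrt hN.le]
  simp_rw [hinner, ← mul_sum] at h
  rw [inv_mul_le_iff₀ hN] at h
  refine le_trans (le_of_eq ?_) h
  rw [← sum_subtype (univ.filter fun i => Nontrivial (V i)) (by simp)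
    fun i => ‖∑ g, conj ((unitaryRep (ρ i)).character g) * f g‖ ^ 2]
  refine (sum_filter_of_ne fun i _ hi => ?_).symm
  by_contra hV
  rw [not_nontrivial_iff_subsingleton] at hV
  have h0 : ∀ g, (unitaryRep (ρ i)).character g = 0 := fun g => by
    rw [Representation.character, Subsingleton.elim (unitaryRep (ρ i) g) 0, map_zero]
  simp [h0] at hi

lemma card_filter_conj_eq_le (g h : G) :
    (univ.filter fun x : G => x * g * x⁻¹ = h).card ≤ centralizerCard g := by
  rcases (univ.filter fun x : G => x * g * x⁻¹ = h).eq_empty_or_nonempty with h0 | ⟨y, hy⟩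
  · simp [h0]
  · refine card_le_card_of_injOn (fun x => y⁻¹ * x) (fun x hx => ?_)
      fun x _ x' _ hxx => mul_left_cancel hxx
    simp only [coe_filter, mem_filter, mem_univ, true_and, Set.mem_ofPred_eq] at hx hy ⊢
    rw [mul_assoc, mul_inv_eq_iff_eq_mul.1 (hx.trans hy.symm)]
    group

/-- The easy half of the second orthogonality relation. -/
lemma sum_sq_norm_character_le [Fintype ι] {ρ : ∀ i, G →* (V i ≃ₗᵢ[ℂ] V i)}
    (hirr : ∀ i, ∀ U : Submodule ℂ (V i), (∀ g : G, ∀ v ∈ U, ρ i g v ∈ U) → U = ⊥ ∨ U = ⊤)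
    (hdisj : ∀ i j, i ≠ j → ∀ f : V i →ₗ[ℂ] V j, (∀ g x, f (ρ i g x) = ρ j g (f x)) → f = 0)
    (g : G) :
    ∑ i, ‖(unitaryRep (ρ i)).character g‖ ^ 2 ≤ centralizerCard g := by
  let f : G → ℕ := fun h => (univ.filter fun x : G => x * g * x⁻¹ = h).card
  have hsum : ∑ h, f h = Fintype.card G := (card_eq_sum_card_fiberwise (by simp)).symm
  have hN : (0 : ℝ) < Fintype.card G := by exact_mod_cast Fintype.card_pos
  have h := sum_sq_norm_sum_character_le hirr hdisj fun h => (f h : ℂ)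
  have h1 : ∀ i, ∑ h, conj ((unitaryRep (ρ i)).character h) * (f h : ℂ) =
      (Fintype.card G : ℝ) * conj ((unitaryRep (ρ i)).character g) := by
    intro i
    calc _ = ∑ h, ∑ x ∈ univ.filter fun x : G => x * g * x⁻¹ = h,
          conj ((unitaryRep (ρ i)).character (x * g * x⁻¹)) := by
          refine sum_congr rfl fun h _ => ?_
          rw [sum_congr rfl fun x hx => by rw [(mem_filter.1 hx).2]]
          simp [f, mul_comm]
      _ = ∑ x : G, conj ((unitaryRep (ρ i)).character (x * g * x⁻¹)) :=
          sum_fiberwise_of_maps_to (fun x _ => mem_univ _) _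
      _ = _ := by simp [Representation.char_conj]
  simp_rw [h1, norm_mul, mul_pow, Complex.norm_real, Real.norm_eq_abs, sq_abs, RCLike.norm_conj,
    ← mul_sum, Complex.norm_natCast] at h
  have h2 : ∑ h, (f h : ℝ) ^ 2 ≤ centralizerCard g * Fintype.card G := by
    rw [← hsum, Nat.cast_sum, mul_sum]
    refine sum_le_sum fun h _ => ?_
    rw [sq]
    have := card_filter_conj_eq_le g h
    gcongr
  have h3 := h.trans (mul_le_mul_of_nonneg_left h2 hN.le)
  refine le_of_mul_le_mul_left (h3.trans (le_of_eq ?_)) (pow_pos hN 2)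
  ring

lemma sum_finrank_mul_re_character_eq_zero [Fintype ι] {ρ : ∀ i, G →* (V i ≃ₗᵢ[ℂ] V i)}
    (hirr : ∀ i, ∀ U : Submodule ℂ (V i), (∀ g : G, ∀ v ∈ U, ρ i g v ∈ U) → U = ⊥ ∨ U = ⊤)
    (hdisj : ∀ i j, i ≠ j → ∀ f : V i →ₗ[ℂ] V j, (∀ g x, f (ρ i g x) = ρ j g (f x)) → f = 0)
    (hcard : ∑ i, (Module.finrank ℂ (V i)) ^ 2 = Fintype.card G) {m : G} (hm : m ≠ 1) :
    ∑ i, (Module.finrank ℂ (V i) : ℝ) * ((unitaryRep (ρ i)).character m).re = 0 := by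
  set S := ∑ i, (Module.finrank ℂ (V i) : ℝ) * ((unitaryRep (ρ i)).character m).re with hS
  have hN : (0 : ℝ) < Fintype.card G := by exact_mod_cast Fintype.card_pos
  have hcard' : ∑ i, (Module.finrank ℂ (V i) : ℝ) ^ 2 = Fintype.card G := by
    exact_mod_cast hcard
  let t : ℝ := S / Fintype.card G
  have h := sum_sq_norm_sum_character_le hirr hdisj
    fun g => (if g = 1 then 1 else 0) + if g = m then (t : ℂ) else 0
  have h1 : ∑ g : G, ‖(if g = 1 then (1 : ℂ) else 0) + if g = m then (t : ℂ) else 0‖ ^ 2 =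
      1 + t ^ 2 := by
    have : ∀ g : G, ‖(if g = 1 then (1 : ℂ) else 0) + if g = m then (t : ℂ) else 0‖ ^ 2 =
        (if g = 1 then 1 else 0) + if g = m then t ^ 2 else 0 := by
      intro g
      by_cases h1 : g = 1
      · simp [h1, hm.symm]
      · by_cases h2 : g = m <;> simp [h1, h2, hm]
    simp [this, sum_add_distrib]
  have h2 : ∀ i, (Module.finrank ℂ (V i) : ℝ) ^ 2 + 2 * t *
      ((Module.finrank ℂ (V i) : ℝ) * ((unitaryRep (ρ i)).character m).re) ≤
      ‖∑ g, conj ((unitaryRep (ρ i)).character g) *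
        ((if g = 1 then (1 : ℂ) else 0) + if g = m then (t : ℂ) else 0)‖ ^ 2 := by
    intro i
    simp only [mul_add, sum_add_distrib, mul_ite, mul_one, mul_zero, sum_ite_eq', mem_univ,
      if_true, Representation.char_one, ← Complex.normSq_eq_norm_sq, Complex.normSq_apply]
    simp
    nlinarith [sq_nonneg (((unitaryRep (ρ i)).character m).re * t),
      sq_nonneg (((unitaryRep (ρ i)).character m).im * t)]
  have h3 := (sum_le_sum fun i (_ : i ∈ univ) => h2 i).trans h
  rw [h1, sum_add_distrib, ← mul_sum, hcard', ← hS] at h3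
  have ht : S = t * Fintype.card G := (div_mul_cancel₀ _ hN.ne').symm
  rw [ht] at h3 ⊢
  have : t = 0 := by
    by_contra h0
    have := mul_pos (pow_pos hN 1) (by positivity : 0 < t ^ 2)
    nlinarith
  rw [this, zero_mul]

end Characters

section HalfProj

variable {G V J : Type*} [Group G] [NormedAddCommGroup V] [InnerProductSpace ℂ V]

lemma norm_sq_halfProj (ρ : G →* (V ≃ₗᵢ[ℂ] V)) (m : G) {b : V} (hb : ‖b‖ = 1) :
    ‖halfProj ρ m b‖ ^ 2 = (1 + (inner ℂ b (ρ m b) : ℂ).re) / 2 := by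
  have h : halfProj ρ m b = (2⁻¹ : ℂ) • (b + ρ m b) := rfl
  have h2 := norm_add_sq (𝕜 := ℂ) b (ρ m b)
  rw [(ρ m).norm_map, hb] at h2
  rw [h, norm_smul, mul_pow, h2]
  simp only [norm_inv, Complex.norm_ofNat, RCLike.re_to_complex]
  ring

variable [FiniteDimensional ℂ V]

lemma finrank_range_halfProj (ρ : G →* (V ≃ₗᵢ[ℂ] V)) {m : G} (hm : m * m = 1) :
    (Module.finrank ℂ (LinearMap.range (halfProj ρ m)) : ℝ) =
      (Module.finrank ℂ V + ((unitaryRep ρ).character m).re) / 2 := by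
  have hmm : ∀ v, ρ m (ρ m v) = v := fun v => by
    have : ρ m * ρ m = 1 := by rw [← map_mul, hm, map_one]
    exact congrArg (fun e : V ≃ₗᵢ[ℂ] V => e v) this
  have hid : IsIdempotentElem (halfProj ρ m) := by
    ext v
    simp only [halfProj, Module.End.mul_apply, LinearMap.smul_apply, LinearMap.add_apply,
      LinearMap.id_apply, map_smul, map_add]
    simp only [LinearEquiv.coe_coe, LinearIsometryEquiv.coe_toLinearEquiv, hmm]
    module
  have h := (LinearMap.IsIdempotentElem.isProj_range _ hid).trace
  have h' : LinearMap.trace ℂ V (halfProj ρ m) =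
      2⁻¹ * (Module.finrank ℂ V + (unitaryRep ρ).character m) := by
    rw [halfProj, map_smul, map_add, LinearMap.trace_id, smul_eq_mul]
    rfl
  rw [h'] at h
  have h2 := congrArg Complex.re h
  rw [Complex.natCast_re] at h2
  rw [← h2]
  norm_num
  ring

/-- The distance to the natural distribution, weighted by the probability of observing the
representation, is controlled by the overlaps `⟨b_j, ρ(m) b_j⟩`. -/
lemma finrank_mul_l1_dist_le [Fintype J] (ρ : G →* (V ≃ₗᵢ[ℂ] V)) {m : G} (hm : m * m = 1)
    {b : J → V} {a : J → ℝ} (hb : ∀ j, ‖b j‖ = 1) (ha : ∀ j, 0 < a j)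
    (hab : ∑ j, (a j : ℂ) • outerSelf (b j) = LinearMap.id) :
    2 * (Module.finrank ℂ V : ℝ) * Module.finrank ℂ (LinearMap.range (halfProj ρ m)) *
      ∑ j, |a j * ‖halfProj ρ m (b j)‖ ^ 2 /
        (Module.finrank ℂ (LinearMap.range (halfProj ρ m)) : ℝ) -
          a j / (Module.finrank ℂ V : ℝ)| ≤
      2 * (Module.finrank ℂ V * ∑ j, a j * ‖(inner ℂ (b j) (ρ m (b j)) : ℂ)‖) := by
  have hrd : Module.finrank ℂ (LinearMap.range (halfProj ρ m)) ≤ Module.finrank ℂ V :=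
    Submodule.finrank_le _
  have hr := finrank_range_halfProj ρ hm
  have hd := frame_sum_weights hb hab
  have hχ : ‖(unitaryRep ρ).character m‖ ≤
      ∑ j, a j * ‖(inner ℂ (b j) (ρ m (b j)) : ℂ)‖ := by
    have h := frame_trace hab (unitaryRep ρ m)
    rw [Representation.character, ← h]
    refine (norm_sum_le _ _).trans (le_of_eq (sum_congr rfl fun j _ => ?_))
    rw [norm_mul, Complex.norm_real, Real.norm_of_nonneg (ha j).le]
    rfl
  set r := Module.finrank ℂ (LinearMap.range (halfProj ρ m))
  set d := Module.finrank ℂ V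
  set χ := (unitaryRep ρ).character m
  have hS : 0 ≤ ∑ j, a j * ‖(inner ℂ (b j) (ρ m (b j)) : ℂ)‖ :=
    sum_nonneg fun j _ => mul_nonneg (ha j).le (norm_nonneg _)
  rcases Nat.eq_zero_or_pos r with h0 | h0
  · rw [h0, Nat.cast_zero, mul_zero, zero_mul]
    positivity
  have hr0 : (0 : ℝ) < r := by exact_mod_cast h0
  have hd0 : (0 : ℝ) < d := hr0.trans_le (by exact_mod_cast hrd)
  calc _ = ∑ j, a j * |d * (inner ℂ (b j) (ρ m (b j)) : ℂ).re - χ.re| := by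
        rw [mul_sum]
        refine sum_congr rfl fun j _ => ?_
        rw [← abs_of_pos (by positivity : (0 : ℝ) < 2 * d * r), ← abs_mul,
          ← abs_of_pos (ha j), ← abs_mul, abs_of_pos (ha j), norm_sq_halfProj ρ m (hb j)]
        congr 1
        have h2r : χ.re = 2 * r - d := by linarith
        rw [h2r]
        field_simp
        ring
    _ ≤ ∑ j, a j * (d * ‖(inner ℂ (b j) (ρ m (b j)) : ℂ)‖ + ‖χ‖) := by
        refine sum_le_sum fun j _ => mul_le_mul_of_nonneg_left ?_ (ha j).le
        refine (abs_sub _ _).trans (add_le_add ?_ (Complex.abs_re_le_norm _))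
        rw [abs_mul, abs_of_pos hd0]
        exact mul_le_mul_of_nonneg_left (Complex.abs_re_le_norm _) hd0.le
    _ = d * ∑ j, a j * ‖(inner ℂ (b j) (ρ m (b j)) : ℂ)‖ + d * ‖χ‖ := by
        simp_rw [mul_add, sum_add_distrib, ← sum_mul, hd, mul_sum]
        congr 1
        exact sum_congr rfl fun j _ => by ring
    _ ≤ _ := by
        have := mul_le_mul_of_nonneg_left hχ hd0.le
        linarith

end HalfProj

/-- Power-mean inequality for an iterated average. -/
lemma pow_eight_sum_average_le {K L : Type*} (s : Finset K) (M : Finset L) (hM : M.Nonempty)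
    {w : K → ℝ} (hw : ∀ k ∈ s, 0 ≤ w k) (hw1 : ∑ k ∈ s, w k = 1) {x : K → L → ℝ}
    (hx : ∀ k l, 0 ≤ x k l) :
    (∑ k ∈ s, w k * ((M.card : ℝ)⁻¹ * ∑ l ∈ M, x k l)) ^ 8 ≤
      (M.card : ℝ)⁻¹ ^ 4 * ∑ k ∈ s, w k * (∑ l ∈ M, x k l ^ 2) ^ 4 := by
  have hM0 : (0 : ℝ) < M.card := by exact_mod_cast hM.card_pos
  have hsum : ∀ k, 0 ≤ ∑ l ∈ M, x k l := fun k => sum_nonneg fun l _ => hx k l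
  refine (Real.pow_arith_mean_le_arith_mean_pow s w _ hw hw1
    (fun k _ => mul_nonneg (inv_nonneg.2 hM0.le) (hsum k)) 8).trans ?_
  rw [mul_sum]
  refine sum_le_sum fun k hk => ?_
  rw [mul_left_comm, ← mul_pow]
  refine mul_le_mul_of_nonneg_left ?_ (hw k hk)
  rw [show 8 = 2 * 4 from rfl, pow_mul]
  refine pow_le_pow_left₀ (by positivity) ?_ 4
  rw [mul_pow, sq (M.card : ℝ)⁻¹, mul_assoc]
  refine mul_le_mul_of_nonneg_left ?_ (inv_nonneg.2 hM0.le)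
  rw [inv_mul_le_iff₀ hM0]
  exact sq_sum_le_card_mul_sum_sq

lemma eventually_const_mul_pow_le_factorial (c C : ℝ) :
    ∃ N : ℕ, ∀ n ≥ N, c * C ^ n ≤ n.factorial := by
  have h := (FloorSemiring.tendsto_pow_div_factorial_atTop C).const_mul c
  rw [mul_zero] at h
  obtain ⟨N, hN⟩ := Filter.eventually_atTop.1 (h.eventually_le_const one_pos)
  refine ⟨N, fun n hn => ?_⟩
  have := hN n hn
  rwa [← mul_div_assoc, div_le_one (by positivity)] at this

section SymmetricGroup

variable {n : ℕ}

lemma pow_four_sum_sq_norm_inner_le {V : Type*} [NormedAddCommGroup V] [InnerProductSpace ℂ V]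
    [FiniteDimensional ℂ V] (ρ : Perm (Fin n) →* (V ≃ₗᵢ[ℂ] V)) {b : V} (hb : ‖b‖ = 1) :
    (∑ m ∈ fpfInvolutions n, ‖(inner ℂ b (ρ m b) : ℂ)‖ ^ 2) ^ 4 ≤
      ∑ p ∈ fpfInvolutions n ×ˢ fpfInvolutions n, ∑ q ∈ fpfInvolutions n ×ˢ fpfInvolutions n,
        ‖(inner ℂ b (ρ ((p.1 * p.2)⁻¹ * (q.1 * q.2)) b) : ℂ)‖ ^ 2 := by
  refine le_trans ?_ (sq_sum_sq_norm_inner_le (fpfInvolutions n ×ˢ fpfInvolutions n)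
    (fun p => p.1 * p.2) ρ hb)
  rw [show 4 = 2 * 2 from rfl, pow_mul]
  refine pow_le_pow_left₀ (by positivity) ?_ 2
  refine (sq_sum_sq_norm_inner_le (fpfInvolutions n) id ρ hb).trans (le_of_eq ?_)
  rw [sum_product]
  refine sum_congr rfl fun k hk => sum_congr rfl fun l _ => ?_
  rw [id, id, fpfInvolutions_inv hk]

variable {ι : Type*} [Fintype ι] {V : ι → Type*} [∀ i, NormedAddCommGroup (V i)]
  [∀ i, InnerProductSpace ℂ (V i)] [∀ i, FiniteDimensional ℂ (V i)]
  {ρ : ∀ i, Perm (Fin n) →* (V i ≃ₗᵢ[ℂ] V i)}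
  {J : ι → Type*} [∀ i, Fintype (J i)] {b : ∀ i, J i → V i} {a : ∀ i, J i → ℝ}

/-- The total probability of the representations. -/
lemma sum_observation_probability
    (hirr : ∀ i, ∀ W : Submodule ℂ (V i),
      (∀ g : Perm (Fin n), ∀ v ∈ W, ρ i g v ∈ W) → W = ⊥ ∨ W = ⊤)
    (hdisj : ∀ i j, i ≠ j → ∀ f : V i →ₗ[ℂ] V j, (∀ g x, f (ρ i g x) = ρ j g (f x)) → f = 0)
    (hcard : ∑ i, (Module.finrank ℂ (V i)) ^ 2 = n.factorial)
    {m : Perm (Fin n)} (hm : m * m = 1) (hm1 : m ≠ 1) :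
    ∑ i, 2 * (Module.finrank ℂ (V i) : ℝ) *
      (Module.finrank ℂ (LinearMap.range (halfProj (ρ i) m)) : ℝ) / (n.factorial : ℝ) = 1 := by
  have h0 := sum_finrank_mul_re_character_eq_zero hirr hdisj
    (by rw [hcard, Fintype.card_perm, Fintype.card_fin]) hm1
  have hcard' : ∑ i, (Module.finrank ℂ (V i) : ℝ) ^ 2 = n.factorial := by exact_mod_cast hcard
  rw [← sum_div, div_eq_one_iff_eq (by positivity), ← hcard', ← sub_eq_zero, ← sum_sub_distrib,
    ← h0]
  refine sum_congr rfl fun i _ => ?_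
  rw [finrank_range_halfProj (ρ i) hm]
  ring

lemma sum_frame_pow_four_le
    (hirr : ∀ i, ∀ W : Submodule ℂ (V i),
      (∀ g : Perm (Fin n), ∀ v ∈ W, ρ i g v ∈ W) → W = ⊥ ∨ W = ⊤)
    (hdisj : ∀ i j, i ≠ j → ∀ f : V i →ₗ[ℂ] V j, (∀ g x, f (ρ i g x) = ρ j g (f x)) → f = 0)
    (hcard : ∑ i, (Module.finrank ℂ (V i)) ^ 2 = n.factorial)
    (hb : ∀ i j, ‖b i j‖ = 1) (ha : ∀ i j, 0 < a i j)
    (hab : ∀ i, ∑ j, (a i j : ℂ) • outerSelf (b i j) = LinearMap.id) :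
    ∑ i, ∑ j, (Module.finrank ℂ (V i) * a i j / n.factorial) *
      (∑ m ∈ fpfInvolutions n, ‖(inner ℂ (b i j) (ρ i m (b i j)) : ℂ)‖ ^ 2) ^ 4 ≤
      √(n.factorial) * (fpfQuadruples n * 2 ^ n) := by
  have hd : ∀ i, (Module.finrank ℂ (V i) : ℝ) ≤ √(n.factorial) := fun i => by
    refine Real.le_sqrt_of_sq_le ?_
    have hcard' : ∑ i, (Module.finrank ℂ (V i) : ℝ) ^ 2 = n.factorial := by exact_mod_cast hcard
    rw [← hcard']
    exact single_le_sum (f := fun i => (Module.finrank ℂ (V i) : ℝ) ^ 2)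
      (fun i _ => by positivity) (mem_univ i)
  have hc : (∑ g : Perm (Fin n), (centralizerCard g : ℝ)) ≤ 2 ^ n * n.factorial := by
    exact_mod_cast sum_centralizerCard_le
  set P := fpfInvolutions n ×ˢ fpfInvolutions n
  have hF : (0 : ℝ) < n.factorial := by positivity
  calc _ ≤ ∑ i, (√(n.factorial) / n.factorial) * ∑ p ∈ P, ∑ q ∈ P,
        ‖(unitaryRep (ρ i)).character ((p.1 * p.2)⁻¹ * (q.1 * q.2))‖ ^ 2 := by
        refine sum_le_sum fun i _ => ?_
        calc _ ≤ ∑ j, (Module.finrank ℂ (V i) / n.factorial : ℝ) * (a i j * ∑ p ∈ P, ∑ q ∈ P,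
              ‖(inner ℂ (b i j) (ρ i ((p.1 * p.2)⁻¹ * (q.1 * q.2)) (b i j)) : ℂ)‖ ^ 2) := by
              refine sum_le_sum fun j _ => ?_
              rw [mul_div_right_comm, mul_assoc]
              have := (ha i j).le
              gcongr
              exact pow_four_sum_sq_norm_inner_le (ρ i) (hb i j)
          _ ≤ _ := by
              rw [← mul_sum]
              gcongr
              · exact sum_nonneg fun j _ => mul_nonneg (ha i j).le (by positivity)
              · exact hd i
              · exact frame_sum_sq_norm_inner_le P (fun p => p.1 * p.2) (ρ i) (hb i) (ha i) (hab i)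
    _ = (√(n.factorial) / n.factorial) * ∑ p ∈ P, ∑ q ∈ P,
        ∑ i, ‖(unitaryRep (ρ i)).character ((p.1 * p.2)⁻¹ * (q.1 * q.2))‖ ^ 2 := by
        rw [← mul_sum, sum_comm]
        congr 1
        exact sum_congr rfl fun p _ => sum_comm
    _ ≤ (√(n.factorial) / n.factorial) * ∑ p ∈ P, ∑ q ∈ P,
        (centralizerCard ((p.1 * p.2)⁻¹ * (q.1 * q.2)) : ℝ) := by
        gcongr
        exact sum_sq_norm_character_le hirr hdisj _
    _ ≤ (√(n.factorial) / n.factorial) * (fpfQuadruples n * (2 ^ n * n.factorial)) := by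
        gcongr
        refine (sum_quadruples_le (fun g => (centralizerCard g : ℝ)) fun g => by positivity).trans ?_
        gcongr
    _ = _ := by
        field_simp

/-- The expected overlap `|⟨b_j, ρ(m) b_j⟩|` is superexponentially small. -/
lemma expected_overlap_pow_le (hn : Even n)
    (hirr : ∀ i, ∀ W : Submodule ℂ (V i),
      (∀ g : Perm (Fin n), ∀ v ∈ W, ρ i g v ∈ W) → W = ⊥ ∨ W = ⊤)
    (hdisj : ∀ i j, i ≠ j → ∀ f : V i →ₗ[ℂ] V j, (∀ g x, f (ρ i g x) = ρ j g (f x)) → f = 0)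
    (hcard : ∑ i, (Module.finrank ℂ (V i)) ^ 2 = n.factorial)
    (hb : ∀ i j, ‖b i j‖ = 1) (ha : ∀ i j, 0 < a i j)
    (hab : ∀ i, ∑ j, (a i j : ℂ) • outerSelf (b i j) = LinearMap.id) :
    (∑ i, ∑ j, (Module.finrank ℂ (V i) * a i j / n.factorial) *
      (((fpfInvolutions n).card : ℝ)⁻¹ *
        ∑ m ∈ fpfInvolutions n, ‖(inner ℂ (b i j) (ρ i m (b i j)) : ℂ)‖)) ^ 32 *
      n.factorial ≤ 2 ^ (27 * n) := by
  have hM0 : 0 < (fpfInvolutions n).card := by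
    have h := factorial_le_card_fpfInvolutions hn
    by_contra h0
    rw [Nat.eq_zero_of_not_pos h0] at h
    simp [n.factorial_ne_zero] at h
  have h := pow_eight_sum_average_le (univ : Finset (Σ i, J i)) (fpfInvolutions n)
    (card_pos.1 hM0) (w := fun k => Module.finrank ℂ (V k.1) * a k.1 k.2 / n.factorial)
    (fun k _ => by have := (ha k.1 k.2).le; positivity)
    (by
      have hcard' : ∑ i, (Module.finrank ℂ (V i) : ℝ) ^ 2 = n.factorial := by
        exact_mod_cast hcard
      have hi : ∀ i, ∑ j, Module.finrank ℂ (V i) * a i j / (n.factorial : ℝ) =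
          (Module.finrank ℂ (V i) : ℝ) ^ 2 / n.factorial := fun i => by
        rw [← sum_div, ← mul_sum, frame_sum_weights (hb i) (hab i), sq]
      rw [Fintype.sum_sigma]
      simp only [hi]
      rw [← sum_div, hcard', div_self (by positivity)])
    (x := fun k m => ‖(inner ℂ (b k.1 k.2) (ρ k.1 m (b k.1 k.2)) : ℂ)‖)
    (fun k m => norm_nonneg _)
  simp_rw [Fintype.sum_sigma] at h
  set E := ∑ i, ∑ j, (Module.finrank ℂ (V i) * a i j / n.factorial) *
      (((fpfInvolutions n).card : ℝ)⁻¹ *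
        ∑ m ∈ fpfInvolutions n, ‖(inner ℂ (b i j) (ρ i m (b i j)) : ℂ)‖)
  have h1 := h.trans (mul_le_mul_of_nonneg_left
    (sum_frame_pow_four_le hirr hdisj hcard hb ha hab) (by positivity))
  have hQ : (fpfQuadruples n : ℝ) ^ 2 ≤ (fpfInvolutions n).card * (16 ^ n * n.factorial) ^ 2 := by
    exact_mod_cast sq_fpfQuadruples_le
  have hF : (n.factorial : ℝ) ≤ 2 ^ n * (fpfInvolutions n).card ^ 2 := by
    exact_mod_cast factorial_le_card_fpfInvolutions hn
  have hM : (0 : ℝ) < (fpfInvolutions n).card := by exact_mod_cast hM0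
  have hF0 : (0 : ℝ) < n.factorial := by positivity
  set M := ((fpfInvolutions n).card : ℝ)
  set F := (n.factorial : ℝ)
  set Q := (fpfQuadruples n : ℝ)
  have h2 : M ^ 16 * E ^ 32 ≤ F ^ 2 * (M ^ 2 * (16 ^ n * F) ^ 4) * 2 ^ (4 * n) := by
    have h3 : M ^ 4 * E ^ 8 ≤ √F * (Q * 2 ^ n) := by
      rwa [inv_pow, le_inv_mul_iff₀ (by positivity)] at h1
    calc M ^ 16 * E ^ 32 = (M ^ 4 * E ^ 8) ^ 4 := by ring
      _ ≤ (√F * (Q * 2 ^ n)) ^ 4 := pow_le_pow_left₀ (by positivity) h3 4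
      _ = (√F ^ 2) ^ 2 * (Q ^ 2) ^ 2 * 2 ^ (4 * n) := by rw [pow_mul']; ring
      _ ≤ F ^ 2 * (M * (16 ^ n * F) ^ 2) ^ 2 * 2 ^ (4 * n) := by
          rw [Real.sq_sqrt hF0.le]
          gcongr
      _ = _ := by ring
  have h4 : (16 : ℝ) ^ n = (2 ^ n) ^ 4 := by
    rw [← pow_mul, mul_comm, pow_mul]
    norm_num
  have h5 : F ^ 7 ≤ 2 ^ (7 * n) * M ^ 14 := by
    calc F ^ 7 ≤ (2 ^ n * M ^ 2) ^ 7 := pow_le_pow_left₀ hF0.le hF 7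
      _ = _ := by rw [pow_mul']; ring
  refine le_of_mul_le_mul_left ?_ (pow_pos hM 16)
  calc M ^ 16 * (E ^ 32 * F) = (M ^ 16 * E ^ 32) * F := by ring
    _ ≤ F ^ 2 * (M ^ 2 * (16 ^ n * F) ^ 4) * 2 ^ (4 * n) * F := by gcongr
    _ = M ^ 2 * 2 ^ (20 * n) * F ^ 7 := by rw [h4, pow_mul' 2 4, pow_mul' 2 20]; ring
    _ ≤ M ^ 2 * 2 ^ (20 * n) * (2 ^ (7 * n) * M ^ 14) := by gcongr
    _ = _ := by rw [pow_mul' 2 20, pow_mul' 2 7, pow_mul' 2 27]; ring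

end SymmetricGroup

/-- **Theorem 2 of the paper.**  Let `n` be even and `M ⊂ S_n` the
conjugacy class of fixed-point-free involutions.  For each member of a complete family of
pairwise non-isomorphic irreducible unitary representations `λ` of `S_n`, fix a frame
`B_λ = {b_j}` of unit vectors with positive weights `{a_j}` satisfying
`Σ_j a_j |b_j⟩⟨b_j| = id`.  Under the joint distribution where `m` is uniform on `M` and
`λ` is observed with probability `P(λ) = 2 d_λ r_λ(m)/n!` (with `r_λ(m) = rk Π_m^λ`),
with probability at least `1 − e^{−δn}` the conditional distribution
`P_m(b_j) = a_j‖Π_m^λ b_j‖²/r_λ` is within total variation distance `e^{−δn}` of the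
natural distribution `N(b_j) = a_j/d_λ`, for some `δ > 0` and all sufficiently large
even `n`. -/
theorem strong_fourier_sampling_povm_close_to_natural :
    ∃ δ > (0 : ℝ), ∃ N : ℕ, ∀ n ≥ N, Even n →
      ∀ (ι : Type) [Fintype ι] (V : ι → Type)
        [∀ i, NormedAddCommGroup (V i)] [∀ i, InnerProductSpace ℂ (V i)]
        [∀ i, FiniteDimensional ℂ (V i)]
        (ρ : ∀ i, Equiv.Perm (Fin n) →* (V i ≃ₗᵢ[ℂ] V i)),
        (∀ i, ∀ W : Submodule ℂ (V i),
          (∀ g : Equiv.Perm (Fin n), ∀ v ∈ W, ρ i g v ∈ W) → W = ⊥ ∨ W = ⊤) →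
        (∀ i j, i ≠ j → ∀ f : V i →ₗ[ℂ] V j,
          (∀ g x, f (ρ i g x) = ρ j g (f x)) → f = 0) →
        (∑ i, (Module.finrank ℂ (V i)) ^ 2 = n.factorial) →
        ∀ (J : ι → Type) (_ : ∀ i, Fintype (J i)) (b : ∀ i, J i → V i)
          (a : ∀ i, J i → ℝ),
        (∀ i j, ‖b i j‖ = 1) →
        (∀ i j, 0 < a i j) →
        (∀ i, ∑ j : J i, (a i j : ℂ) • outerSelf (b i j) = LinearMap.id) →
        1 - Real.exp (-δ * n) ≤
          (((Finset.univ.filter (fun m : Equiv.Perm (Fin n) =>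
              m * m = 1 ∧ ∀ x, m x ≠ x)).card : ℝ))⁻¹ *
          ∑ m ∈ Finset.univ.filter (fun m : Equiv.Perm (Fin n) =>
              m * m = 1 ∧ ∀ x, m x ≠ x),
            ∑ i ∈ Finset.univ.filter (fun i =>
                (∑ j : J i,
                  |a i j * ‖halfProj (ρ i) m (b i j)‖ ^ 2 /
                      (Module.finrank ℂ (LinearMap.range (halfProj (ρ i) m)) : ℝ) -
                    a i j / (Module.finrank ℂ (V i) : ℝ)|)
                  < Real.exp (-δ * n)),
              2 * (Module.finrank ℂ (V i) : ℝ) *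
                (Module.finrank ℂ (LinearMap.range (halfProj (ρ i) m)) : ℝ) /
                (n.factorial : ℝ) := by
  obtain ⟨N, hN⟩ := eventually_const_mul_pow_le_factorial (2 ^ 32) (2 ^ 27 * Real.exp 64)
  refine ⟨1, one_pos, max N 1, ?_⟩
  intro n hnN hn ι _ V _ _ _ ρ hirr hdisj hcard J _ b a hb ha hab
  change _ ≤ ((fpfInvolutions n).card : ℝ)⁻¹ * ∑ m ∈ fpfInvolutions n, _
  have hpow := expected_overlap_pow_le hn hirr hdisj hcard hb ha hab
  have hM : (0 : ℝ) < (fpfInvolutions n).card := by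
    have h := factorial_le_card_fpfInvolutions hn
    rw [Nat.cast_pos]
    by_contra h0
    rw [Nat.eq_zero_of_not_pos h0] at h
    simp [n.factorial_ne_zero] at h
  have hfact : (0 : ℝ) < n.factorial := by positivity
  set M := fpfInvolutions n
  set E := ∑ i, ∑ j, (Module.finrank ℂ (V i) * a i j / n.factorial) *
    ((M.card : ℝ)⁻¹ * ∑ m ∈ M, ‖(inner ℂ (b i j) (ρ i m (b i j)) : ℂ)‖) with hE
  set ε := Real.exp (-1 * n) with hε
  have hε0 : 0 < ε := Real.exp_pos _
  have hE0 : 0 ≤ E := sum_nonneg fun i _ => sum_nonneg fun j _ => by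
    have := (ha i j).le
    positivity
  have hsmall : 2 * E ≤ ε ^ 2 := by
    refine le_of_pow_le_pow_left₀ (n := 32) (by norm_num) (by positivity) ?_
    have h1 := hN n (le_of_max_le_left hnN)
    have h2 : ε ^ 64 * Real.exp 64 ^ n = 1 := by
      rw [hε, ← Real.exp_nat_mul, ← Real.exp_nat_mul, ← Real.exp_add, Real.exp_eq_one_iff]
      push_cast
      ring
    refine le_of_mul_le_mul_right ?_ hfact
    calc (2 * E) ^ 32 * n.factorial = 2 ^ 32 * (E ^ 32 * n.factorial) := by ring
      _ ≤ 2 ^ 32 * 2 ^ (27 * n) := by gcongr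
      _ = ε ^ 64 * (2 ^ 32 * (2 ^ 27 * Real.exp 64) ^ n) := by
          rw [mul_pow, pow_mul]
          linear_combination -(2 ^ 32 * (2 ^ 27) ^ n : ℝ) * h2
      _ ≤ ε ^ 64 * n.factorial := by gcongr
      _ = (ε ^ 2) ^ 32 * n.factorial := by ring
  let w : Perm (Fin n) → ι → ℝ := fun m i => 2 * (Module.finrank ℂ (V i) : ℝ) *
    (Module.finrank ℂ (LinearMap.range (halfProj (ρ i) m)) : ℝ) / (n.factorial : ℝ)
  let D : Perm (Fin n) → ι → ℝ := fun m i => ∑ j : J i,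
    |a i j * ‖halfProj (ρ i) m (b i j)‖ ^ 2 /
      (Module.finrank ℂ (LinearMap.range (halfProj (ρ i) m)) : ℝ) -
        a i j / (Module.finrank ℂ (V i) : ℝ)|
  change 1 - ε ≤ (M.card : ℝ)⁻¹ * ∑ m ∈ M, ∑ i ∈ univ.filter (fun i => D m i < ε), w m i
  have hw : ∀ m i, 0 ≤ w m i := fun m i => by positivity
  have hD : ∀ m i, 0 ≤ D m i := fun m i => by positivity
  have hmarkov : ∀ m ∈ M, 1 - ε⁻¹ * ∑ i, w m i * D m i ≤
      ∑ i ∈ univ.filter (fun i => D m i < ε), w m i := by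
    intro m hm
    obtain ⟨hmm, hfix⟩ := mem_fpfInvolutions.1 hm
    have hm1 : m ≠ 1 := fun h =>
      hfix ⟨0, le_of_max_le_right hnN⟩ (by rw [h, Perm.one_apply])
    rw [← sum_observation_probability hirr hdisj hcard hmm hm1, mul_sum, ← sum_sub_distrib,
      sum_filter]
    refine sum_le_sum fun i _ => ?_
    change w m i - _ ≤ _
    split_ifs with h
    · have := mul_nonneg (inv_nonneg.2 hε0.le) (mul_nonneg (hw m i) (hD m i))
      linarith
    · have : w m i ≤ ε⁻¹ * (w m i * D m i) := by
        rw [le_inv_mul_iff₀ hε0, mul_comm]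
        exact mul_le_mul_of_nonneg_left (not_lt.1 h) (hw m i)
      linarith
  have hexp : (M.card : ℝ)⁻¹ * ∑ m ∈ M, ∑ i, w m i * D m i ≤ 2 * E := by
    calc _ ≤ (M.card : ℝ)⁻¹ * ∑ m ∈ M, ∑ i, 2 * (Module.finrank ℂ (V i) *
          ∑ j, a i j * ‖(inner ℂ (b i j) (ρ i m (b i j)) : ℂ)‖) / n.factorial := by
          gcongr with m hm i _
          rw [div_mul_eq_mul_div]
          refine div_le_div_of_nonneg_right ?_ hfact.le
          exact finrank_mul_l1_dist_le (ρ i) (mem_fpfInvolutions.1 hm).1 (hb i) (ha i) (hab i)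
      _ = 2 * E := by
          rw [hE, sum_comm, mul_sum, mul_sum]
          refine sum_congr rfl fun i _ => ?_
          simp_rw [mul_sum, sum_div, mul_sum]
          rw [sum_comm]
          exact sum_congr rfl fun j _ => sum_congr rfl fun m _ => by ring
  calc 1 - ε ≤ 1 - ε⁻¹ * (2 * E) := by
        have : ε⁻¹ * (2 * E) ≤ ε := by
          rw [inv_mul_le_iff₀ hε0, ← sq]
          exact hsmall
        linarith
    _ ≤ 1 - ε⁻¹ * ((M.card : ℝ)⁻¹ * ∑ m ∈ M, ∑ i, w m i * D m i) := by gcongr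
    _ = (M.card : ℝ)⁻¹ * ∑ m ∈ M, (1 - ε⁻¹ * ∑ i, w m i * D m i) := by
        rw [sum_sub_distrib, ← mul_sum, sum_const, nsmul_eq_mul, mul_one, mul_sub,
          inv_mul_cancel₀ hM.ne']
        ring
    _ ≤ _ := by
        gcongr with m hm
        exact hmarkov m hm
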